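/- For every n ≥ 6: ZC1(PC(1^{n−5}, 2, 1, 1)) < ZC1(PC(2, 1^{n−4}, 2)) and ZC1(PC(2^{n−5}, 1, 2, 2)) > ZC1(PC(1, 2^{n−4}, 1)). -/

import Mathlib

noncomputable section
open scoped Classical
open Finset

/-- Taxicab (L¹) distance between two lattice points. -/
def taxicab (u v : ℤ × ℤ) : ℕ := (u.1 - v.1).natAbs + (u.2 - v.2).natAbs

/-- `c 0, …, c (n-1)` are the lower-left corners of the `n` unit squares of a
polyomino chain: the cells are pairwise distinct and two cells share a common
edge (i.e. their lower-left corners are at taxicab distance 1) iff they are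
consecutive in the chain, so that the centers of the squares form a path. -/
def IsPolyominoChain (n : ℕ) (c : ℕ → ℤ × ℤ) : Prop :=
  (∀ i j, i < n → j < n → c i = c j → i = j) ∧
  (∀ i j, i < n → j < n → (taxicab (c i) (c j) = 1 ↔ (i = j + 1 ∨ j = i + 1)))

/-- `v` is a corner of the unit square with lower-left corner `s`. -/
def IsSquareCorner (s v : ℤ × ℤ) : Prop :=
  v = s ∨ v = s + (1, 0) ∨ v = s + (0, 1) ∨ v = s + (1, 1)

/-- The vertex set of the graph of a polyomino chain: all corners of its squares. -/
def corners (n : ℕ) (c : ℕ → ℤ × ℤ) : Finset (ℤ × ℤ) :=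
  (Finset.range n).biUnion fun i => {c i, c i + (1, 0), c i + (0, 1), c i + (1, 1)}

/-- The graph of a polyomino chain: vertices are corners of the squares, and
two corners are adjacent iff they are the endpoints of a unit side of one of
the squares of the chain. -/
def chainGraph (n : ℕ) (c : ℕ → ℤ × ℤ) : SimpleGraph (ℤ × ℤ) :=
  SimpleGraph.fromRel fun u v =>
    taxicab u v = 1 ∧ ∃ i < n, IsSquareCorner (c i) u ∧ IsSquareCorner (c i) v

/-- `tau n c v` = number of vertices of the chain graph at graph distance exactly 2 from `v`. -/
def tau (n : ℕ) (c : ℕ → ℤ × ℤ) (v : ℤ × ℤ) : ℕ :=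
  ((corners n c).filter fun u => (chainGraph n c).dist v u = 2).card

/-- First Zagreb connection index `ZC1 = ∑_{v ∈ V} τ_v²`. -/
def ZC1 (n : ℕ) (c : ℕ → ℤ × ℤ) : ℕ := ∑ v ∈ corners n c, tau n c v ^ 2

/-- Second Zagreb connection index `ZC2 = ∑_{uv ∈ E} τ_u · τ_v`
(each edge appears twice in the double sum, whence the division by 2). -/
def ZC2 (n : ℕ) (c : ℕ → ℤ × ℤ) : ℕ :=
  (∑ u ∈ corners n c, ∑ v ∈ corners n c,
      if (chainGraph n c).Adj u v then tau n c u * tau n c v else 0) / 2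

/-- The link `L_k` (for `3 ≤ k ≤ n`) of a polyomino chain: `1` if the `k`-th
square continues the current straight segment, `2` if it is attached at a kink. -/
def link (c : ℕ → ℤ × ℤ) (k : ℕ) : ℕ :=
  if c (k - 1) - c (k - 2) = c (k - 2) - c (k - 3) then 1 else 2

/-- Indicator of a proposition, as an integer. -/
def ind (P : Prop) : ℤ := if P then 1 else 0

/-- The chain `c` with `n` squares has `m` segments, of lengths `l 1, …, l m`:
there are cut positions `2 = k 0 < k 1 < ⋯ < k (m-1) < k m = n+1` such that the
kink links (links equal to 2) are exactly at positions `k 1, …, k (m-1)`, and the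
`j`-th segment has length `l j = k j - k (j-1) + 1`. -/
def HasSegments (n : ℕ) (c : ℕ → ℤ × ℤ) (m : ℕ) (l : ℕ → ℕ) : Prop :=
  ∃ k : ℕ → ℕ, k 0 = 2 ∧ k m = n + 1 ∧
    (∀ j, 1 ≤ j → j ≤ m → k (j - 1) < k j) ∧
    (∀ x, 3 ≤ x → x ≤ n → (link c x = 2 ↔ ∃ j, 1 ≤ j ∧ j ≤ m - 1 ∧ k j = x)) ∧
    (∀ j, 1 ≤ j → j ≤ m → l j = k j - k (j - 1) + 1)

/-- The chain `c` with `n` squares has link sequence `L_3, …, L_n`. -/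
def HasLinks (n : ℕ) (c : ℕ → ℤ × ℤ) (L : ℕ → ℕ) : Prop :=
  ∀ k, 3 ≤ k → k ≤ n → link c k = L k

/-- The linear chain `Li_n` (all links equal to 1). -/
def linCell : ℕ → ℤ × ℤ := fun i => ((i : ℤ), 0)

/-- The zigzag chain `Z_n` (all links equal to 2). -/
def zigCell : ℕ → ℤ × ℤ := fun i => ((((i + 1) / 2 : ℕ) : ℤ), ((i / 2 : ℕ) : ℤ))

/-- The number of vertices at distance two from the origin in the graph of the cells in `Q`;
the twelve cells inspected are the only relevant ones. -/
def localTau (Q : ℤ × ℤ → Bool) : ℕ :=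
  ((Q (0, 0) || Q (0, -1)) && (Q (1, 0) || Q (1, -1))).toNat +
  ((Q (-1, 0) || Q (-1, -1)) && (Q (-2, 0) || Q (-2, -1))).toNat +
  ((Q (0, 0) || Q (-1, 0)) && (Q (0, 1) || Q (-1, 1))).toNat +
  ((Q (0, -1) || Q (-1, -1)) && (Q (0, -2) || Q (-1, -2))).toNat +
  ((Q (0, 0) || Q (0, -1)) && (Q (1, 0) || Q (0, 0)) ||
    (Q (0, 0) || Q (-1, 0)) && (Q (0, 1) || Q (0, 0))).toNat +
  ((Q (-1, 0) || Q (-1, -1)) && (Q (-1, 0) || Q (-2, 0)) ||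
    (Q (0, 0) || Q (-1, 0)) && (Q (-1, 1) || Q (-1, 0))).toNat +
  ((Q (0, 0) || Q (0, -1)) && (Q (1, -1) || Q (0, -1)) ||
    (Q (0, -1) || Q (-1, -1)) && (Q (0, -1) || Q (0, -2))).toNat +
  ((Q (-1, 0) || Q (-1, -1)) && (Q (-1, -1) || Q (-2, -1)) ||
    (Q (0, -1) || Q (-1, -1)) && (Q (-1, -1) || Q (-1, -2))).toNat

/-- The vertices, relative to the corner of a cell, whose neighbourhood contains this cell. -/
def nearVertices : Finset (ℤ × ℤ) :=
  {(-1, 0), (0, 0), (1, 0), (2, 0), (-1, 1), (0, 1), (1, 1), (2, 1),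
    (0, -1), (1, -1), (0, 2), (1, 2)}

/-- The increase of `ZC1` when the cell at the origin is added to the cells in `l`. -/
def gain (l : List (ℤ × ℤ)) : ℤ :=
  ∑ w ∈ nearVertices, ((localTau fun o => ((0, 0) :: l).contains (w + o)) ^ 2 -
    (localTau fun o => l.contains (w + o)) ^ 2 : ℤ)

/-- The value of `ZC1` for the chain with the given cells. -/
def listZC1 : List (ℤ × ℤ) → ℤ
  | [] => 0
  | s :: l => listZC1 l + gain (l.map (· - s))

/-- The pairs of perpendicular lattice directions. -/
def frames : List ((ℤ × ℤ) × (ℤ × ℤ)) :=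
  [((1, 0), (0, 1)), ((1, 0), (0, -1)), ((-1, 0), (0, 1)), ((-1, 0), (0, -1)),
   ((0, 1), (1, 0)), ((0, 1), (-1, 0)), ((0, -1), (1, 0)), ((0, -1), (-1, 0))]

theorem chainGraph_adj {n : ℕ} {c : ℕ → ℤ × ℤ} {u v : ℤ × ℤ} :
    (chainGraph n c).Adj u v ↔
      taxicab u v = 1 ∧ ∃ i < n, IsSquareCorner (c i) u ∧ IsSquareCorner (c i) v := by
  have hcomm : taxicab v u = taxicab u v := by simp only [taxicab]; omega
  simp only [chainGraph, SimpleGraph.fromRel_adj, hcomm]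
  constructor
  · rintro ⟨-, h | ⟨h, i, hi, hu, hv⟩⟩
    · exact h
    · exact ⟨h, i, hi, hv, hu⟩
  · rintro h
    refine ⟨?_, Or.inl h⟩
    rintro rfl
    simp [taxicab] at h

theorem chainGraph_dist_eq_two {n : ℕ} {c : ℕ → ℤ × ℤ} {u v : ℤ × ℤ} :
    (chainGraph n c).dist v u = 2 ↔
      taxicab v u = 2 ∧ ∃ w, (chainGraph n c).Adj v w ∧ (chainGraph n c).Adj w u := by
  constructor
  · intro h
    have hr : (chainGraph n c).Reachable v u := by
      by_contra hr
      rw [SimpleGraph.dist_eq_zero_of_not_reachable hr] at h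
      omega
    have huv : v ≠ u := by
      rintro rfl
      simp at h
    obtain ⟨p, hp⟩ := hr.exists_walk_length_eq_dist
    rw [h] at hp
    obtain _ | ⟨h1, _ | ⟨h2, _ | ⟨_, _⟩⟩⟩ := p <;> simp at hp
    · refine ⟨?_, _, h1, h2⟩
      have t1 := (chainGraph_adj.1 h1).1
      have t2 := (chainGraph_adj.1 h2).1
      have : ¬ (v.1 = u.1 ∧ v.2 = u.2) := fun h => huv (Prod.ext h.1 h.2)
      simp only [taxicab] at *
      omega
  · rintro ⟨ht, w, h1, h2⟩
    have hle := SimpleGraph.dist_le (SimpleGraph.Walk.cons h1 (.cons h2 .nil))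
    have h0 : (chainGraph n c).dist v u ≠ 0 := by
      rw [Ne, (h1.reachable.trans h2.reachable).dist_eq_zero_iff]
      rintro rfl
      simp [taxicab] at ht
    have h1 : (chainGraph n c).dist v u ≠ 1 := by
      rw [Ne, SimpleGraph.dist_eq_one_iff_adj, chainGraph_adj]
      omega
    simp only [SimpleGraph.Walk.length_cons, SimpleGraph.Walk.length_nil] at hle
    omega

theorem mem_corners {n : ℕ} {c : ℕ → ℤ × ℤ} {v : ℤ × ℤ} :
    v ∈ corners n c ↔ ∃ i < n, IsSquareCorner (c i) v := by
  simp [corners, IsSquareCorner]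

/-- Membership of a lattice point in the set of cells of a chain. -/
def isCell (n : ℕ) (c : ℕ → ℤ × ℤ) (s : ℤ × ℤ) : Bool := decide (∃ i < n, c i = s)

theorem isCell_iff {n : ℕ} {c : ℕ → ℤ × ℤ} {s : ℤ × ℤ} :
    isCell n c s = true ↔ ∃ i < n, c i = s := by simp [isCell]

theorem isSquareCorner_iff {s v : ℤ × ℤ} :
    IsSquareCorner s v ↔ s = v ∨ s = v + (-1, 0) ∨ s = v + (0, -1) ∨ s = v + (-1, -1) := by
  simp only [IsSquareCorner, Prod.ext_iff, Prod.fst_add, Prod.snd_add]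
  omega

theorem chainGraph_adj_horizontal {n : ℕ} {c : ℕ → ℤ × ℤ} {u v : ℤ × ℤ}
    (h : u.1 + 1 = v.1 ∧ u.2 = v.2) :
    (chainGraph n c).Adj u v ↔ isCell n c u = true ∨ isCell n c (u + (0, -1)) = true := by
  rw [chainGraph_adj, isCell_iff, isCell_iff, ← exists_or]
  have ht : taxicab u v = 1 := by simp only [taxicab]; omega
  simp only [ht, true_and, ← and_or_left]
  refine exists_congr fun i => and_congr_right fun _ => ?_
  simp only [isSquareCorner_iff, Prod.ext_iff, Prod.fst_add, Prod.snd_add]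
  omega

theorem chainGraph_adj_vertical {n : ℕ} {c : ℕ → ℤ × ℤ} {u v : ℤ × ℤ}
    (h : u.1 = v.1 ∧ u.2 + 1 = v.2) :
    (chainGraph n c).Adj u v ↔ isCell n c u = true ∨ isCell n c (u + (-1, 0)) = true := by
  rw [chainGraph_adj, isCell_iff, isCell_iff, ← exists_or]
  have ht : taxicab u v = 1 := by simp only [taxicab]; omega
  simp only [ht, true_and, ← and_or_left]
  refine exists_congr fun i => and_congr_right fun _ => ?_
  simp only [isSquareCorner_iff, Prod.ext_iff, Prod.fst_add, Prod.snd_add]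
  omega

/-- The displacements of taxicab length two. -/
def secondOffsets : Finset (ℤ × ℤ) :=
  {(2, 0), (-2, 0), (0, 2), (0, -2), (1, 1), (-1, 1), (1, -1), (-1, -1)}

theorem exists_adj_adj_iff {n : ℕ} {c : ℕ → ℤ × ℤ} (v o : ℤ × ℤ) :
    (∃ w, (chainGraph n c).Adj v w ∧ (chainGraph n c).Adj w (v + o)) ↔
      ∃ p ∈ ({(1, 0), (-1, 0), (0, 1), (0, -1)} : Finset (ℤ × ℤ)), taxicab p o = 1 ∧
        (chainGraph n c).Adj v (v + p) ∧ (chainGraph n c).Adj (v + p) (v + o) := by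
  constructor
  · rintro ⟨w, h1, h2⟩
    obtain ⟨p, rfl⟩ : ∃ p, w = v + p := ⟨w - v, by abel⟩
    refine ⟨p, ?_, ?_, h1, h2⟩
    · have := (chainGraph_adj.1 h1).1
      simp only [taxicab, Prod.fst_add, Prod.snd_add] at this
      simp only [mem_insert, mem_singleton, Prod.ext_iff]
      omega
    · have := (chainGraph_adj.1 h2).1
      simp only [taxicab, Prod.fst_add, Prod.snd_add] at *
      omega
  · rintro ⟨p, -, -, h1, h2⟩
    exact ⟨_, h1, h2⟩

theorem chainGraph_adj_add {n : ℕ} {c : ℕ → ℤ × ℤ} (v p q : ℤ × ℤ) :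
    (chainGraph n c).Adj (v + p) (v + q) ↔
      if p.1 + 1 = q.1 ∧ p.2 = q.2 then
        isCell n c (v + p) = true ∨ isCell n c (v + (p + (0, -1))) = true
      else if q.1 + 1 = p.1 ∧ p.2 = q.2 then
        isCell n c (v + q) = true ∨ isCell n c (v + (q + (0, -1))) = true
      else if p.1 = q.1 ∧ p.2 + 1 = q.2 then
        isCell n c (v + p) = true ∨ isCell n c (v + (p + (-1, 0))) = true
      else if p.1 = q.1 ∧ q.2 + 1 = p.2 then
        isCell n c (v + q) = true ∨ isCell n c (v + (q + (-1, 0))) = true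
      else False := by
  simp only [← add_assoc]
  split_ifs with h1 h2 h3 h4
  · exact chainGraph_adj_horizontal (by simp only [Prod.fst_add, Prod.snd_add]; omega)
  · rw [SimpleGraph.adj_comm]
    exact chainGraph_adj_horizontal (by simp only [Prod.fst_add, Prod.snd_add]; omega)
  · exact chainGraph_adj_vertical (by simp only [Prod.fst_add, Prod.snd_add]; omega)
  · rw [SimpleGraph.adj_comm]
    exact chainGraph_adj_vertical (by simp only [Prod.fst_add, Prod.snd_add]; omega)
  · rw [iff_false, chainGraph_adj]
    rintro ⟨h, -⟩
    simp only [taxicab, Prod.fst_add, Prod.snd_add] at h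
    omega

theorem tau_eq_localTau (n : ℕ) (c : ℕ → ℤ × ℤ) (v : ℤ × ℤ) :
    tau n c v = localTau fun o => isCell n c (v + o) := by
  have h1 : (corners n c).filter (fun u => (chainGraph n c).dist v u = 2) =
      (secondOffsets.filter fun o =>
        ∃ w, (chainGraph n c).Adj v w ∧ (chainGraph n c).Adj w (v + o)).map
          (addLeftEmbedding v) := by
    ext u
    simp only [mem_filter, mem_map, addLeftEmbedding_apply, chainGraph_dist_eq_two]
    constructor
    · rintro ⟨-, ht, h⟩
      refine ⟨u - v, ⟨?_, by simpa using h⟩, by abel⟩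
      simp only [secondOffsets, mem_insert, mem_singleton, Prod.ext_iff, Prod.fst_sub,
        Prod.snd_sub]
      simp only [taxicab] at ht
      omega
    · rintro ⟨o, ⟨ho, h⟩, rfl⟩
      refine ⟨?_, ?_, h⟩
      · obtain ⟨w, -, h⟩ := h
        obtain ⟨-, i, hi, -, hc⟩ := chainGraph_adj.1 h
        exact mem_corners.2 ⟨i, hi, hc⟩
      · simp only [secondOffsets, mem_insert, mem_singleton, Prod.ext_iff] at ho
        simp only [taxicab, Prod.fst_add, Prod.snd_add]
        omega
  rw [tau, h1, card_map, card_filter]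
  simp only [exists_adj_adj_iff]
  simp only [secondOffsets]
  repeat rw [sum_insert (by decide)]
  rw [sum_singleton]
  simp only [exists_mem_insert, mem_singleton, exists_eq_left]
  simp (decide := true) only [true_and, false_and, or_false, false_or]
  have h0 (p : ℤ × ℤ) : (chainGraph n c).Adj v (v + p) ↔
      (chainGraph n c).Adj (v + (0, 0)) (v + p) := by
    rw [Prod.mk_zero_zero, add_zero]
  simp (decide := true) only [h0, chainGraph_adj_add, if_true, if_false]
  have hb (b : Bool) : (if b = true then 1 else 0 : ℕ) = b.toNat := by cases b <;> rfl
  simp only [← Bool.or_eq_true, ← Bool.and_eq_true, hb]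
  simp only [localTau, Prod.mk_add_mk]
  norm_num only
  ring

/-- The cells, relative to a vertex, on which `localTau` depends. -/
def nearCells : Finset (ℤ × ℤ) :=
  {(0, 0), (0, -1), (1, 0), (1, -1), (-1, 0), (-1, -1), (-2, 0), (-2, -1),
    (0, 1), (-1, 1), (0, -2), (-1, -2)}

theorem localTau_congr {P Q : ℤ × ℤ → Bool} (h : ∀ o ∈ nearCells, P o = Q o) :
    localTau P = localTau Q := by
  simp only [nearCells, mem_insert, mem_singleton, forall_eq_or_imp, forall_eq] at h
  simp only [localTau, h]

theorem tau_eq_zero_of_notMem_corners {n : ℕ} {c : ℕ → ℤ × ℤ} {v : ℤ × ℤ}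
    (hv : v ∉ corners n c) : tau n c v = 0 := by
  rw [tau, card_eq_zero, filter_eq_empty_iff]
  intro u _ h
  obtain ⟨-, w, h, -⟩ := chainGraph_dist_eq_two.1 h
  obtain ⟨-, i, hi, hc, -⟩ := chainGraph_adj.1 h
  exact hv (mem_corners.2 ⟨i, hi, hc⟩)

theorem ZC1_eq_sum_of_subset {n : ℕ} {c : ℕ → ℤ × ℤ} {T : Finset (ℤ × ℤ)}
    (hT : corners n c ⊆ T) : ZC1 n c = ∑ v ∈ T, tau n c v ^ 2 :=
  sum_subset hT fun v _ hv => by simp [tau_eq_zero_of_notMem_corners hv]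

theorem tau_succ_of_notMem {n : ℕ} {c : ℕ → ℤ × ℤ} {v : ℤ × ℤ} (hv : v - c n ∉ nearVertices) :
    tau (n + 1) c v = tau n c v := by
  rw [tau_eq_localTau, tau_eq_localTau]
  refine localTau_congr fun o ho => ?_
  rw [Bool.eq_iff_iff, isCell_iff, isCell_iff, Nat.exists_lt_succ_right]
  refine or_iff_left fun h => hv ?_
  rw [h]
  rw [sub_add_cancel_left]
  clear h
  revert o
  decide

/-- Adding a cell changes `ZC1` by an amount that depends only on the cells at taxicab distance
at most four. -/
theorem ZC1_succ {n : ℕ} {c : ℕ → ℤ × ℤ} (l : List (ℤ × ℤ))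
    (hl : ∀ s ∈ l, ∃ i < n, c i - c n = s)
    (hfar : ∀ i < n, c i - c n ∈ l ∨ 5 ≤ taxicab (c i) (c n)) :
    (ZC1 (n + 1) c : ℤ) = ZC1 n c + gain l := by
  have hsub : corners n c ⊆ corners (n + 1) c := fun v hv => by
    obtain ⟨i, hi, h⟩ := mem_corners.1 hv
    exact mem_corners.2 ⟨i, by omega, h⟩
  set B := nearVertices.map (addLeftEmbedding (c n)) with hB
  have hcell (s : ℤ × ℤ) (hs : taxicab s 0 ≤ 4) : isCell n c (c n + s) = l.contains s := by
    rw [Bool.eq_iff_iff, isCell_iff, List.contains_iff_mem]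
    constructor
    · rintro ⟨i, hi, h⟩
      rcases hfar i hi with h' | h'
      · rwa [h, add_sub_cancel_left] at h'
      · rw [h] at h'
        simp only [taxicab, Prod.fst_add, Prod.snd_add, Prod.fst_zero, Prod.snd_zero] at *
        omega
    · intro h
      obtain ⟨i, hi, h⟩ := hl s h
      exact ⟨i, hi, by rw [← h]; abel⟩
  have hcell' (s : ℤ × ℤ) (hs : taxicab s 0 ≤ 4) :
      isCell (n + 1) c (c n + s) = ((0, 0) :: l).contains s := by
    have := hcell s hs
    rw [Bool.eq_iff_iff, isCell_iff, List.contains_iff_mem] at *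
    rw [Nat.exists_lt_succ_right, this, List.mem_cons, or_comm]
    simp only [left_eq_add]
    exact Iff.rfl
  have hnear : ∀ w ∈ nearVertices, ∀ o ∈ nearCells, taxicab (w + o) 0 ≤ 4 := by decide
  rw [ZC1_eq_sum_of_subset (hsub.trans (subset_union_left (s₂ := B))),
    ZC1_eq_sum_of_subset (subset_union_left (s₁ := corners (n + 1) c) (s₂ := B)),
    ← sub_eq_iff_eq_add']
  push_cast
  rw [← sum_sub_distrib, ← sum_subset (subset_union_right (s₂ := B)), hB, sum_map, gain]
  · refine sum_congr rfl fun w hw => ?_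
    simp only [addLeftEmbedding_apply, tau_eq_localTau, add_assoc]
    rw [localTau_congr fun o ho => hcell' _ (hnear w hw o ho),
      localTau_congr fun o ho => hcell _ (hnear w hw o ho)]
  · intro v _ hv
    rw [tau_succ_of_notMem, sub_self]
    intro h
    exact hv (mem_map.2 ⟨_, h, by simp⟩)

theorem ZC1_zero (c : ℕ → ℤ × ℤ) : ZC1 0 c = 0 := by simp [ZC1, corners]

theorem ZC1_eq_listZC1 (n : ℕ) (c : ℕ → ℤ × ℤ) :
    (ZC1 n c : ℤ) = listZC1 ((List.range n).map c).reverse := by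
  induction n with
  | zero => simp [ZC1_zero, listZC1]
  | succ n ih =>
    rw [List.range_succ, List.map_append, List.reverse_append, ZC1_succ, ih]
    · rfl
    · simp
    · intro i hi
      left
      simpa using ⟨i, hi, rfl⟩

theorem listZC1_map_add (o : ℤ × ℤ) (l : List (ℤ × ℤ)) :
    listZC1 (l.map (o + ·)) = listZC1 l := by
  induction l with
  | nil => rfl
  | cons s l ih => simp [listZC1, ih, Function.comp_def]

/-- `ZC1` of a chain given by its cells relative to a base point. -/
theorem ZC1_eq_listZC1_of_eq_add {n : ℕ} {c : ℕ → ℤ × ℤ} (o : ℤ × ℤ) (f : ℕ → ℤ × ℤ)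
    (h : ∀ i < n, c i = o + f i) :
    (ZC1 n c : ℤ) = listZC1 ((List.range n).map f).reverse := by
  have hmap : (List.range n).map c = ((List.range n).map f).map (o + ·) := by
    rw [List.map_map]
    exact List.map_congr_left (by simpa using h)
  rw [ZC1_eq_listZC1, hmap, ← List.map_reverse, listZC1_map_add]

theorem ZC1_succ_of_window {n K : ℕ} {c : ℕ → ℤ × ℤ} (p : (ℤ × ℤ) × (ℤ × ℤ)) (A B : ℕ → ℤ)
    (hK : K ≤ n) (h : ∀ i < K, c (n - 1 - i) - c n = A i • p.1 + B i • p.2)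
    (hfar : ∀ j, j + K < n → 5 ≤ taxicab (c j) (c n)) :
    (ZC1 (n + 1) c : ℤ) =
      ZC1 n c + gain ((List.range K).map fun i => A i • p.1 + B i • p.2) := by
  apply ZC1_succ
  · simp only [List.mem_map, List.mem_range]
    rintro s ⟨i, hi, rfl⟩
    exact ⟨n - 1 - i, by omega, h i hi⟩
  · intro j hj
    by_cases hjK : j + K < n
    · exact Or.inr (hfar j hjK)
    · left
      simp only [List.mem_map, List.mem_range]
      refine ⟨n - 1 - j, by omega, ?_⟩
      rw [← h _ (by omega)]
      congr 2
      omega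

theorem mem_frames_iff {p : (ℤ × ℤ) × (ℤ × ℤ)} :
    p ∈ frames ↔ taxicab p.1 0 = 1 ∧ (p.2 = (-p.1.2, p.1.1) ∨ p.2 = (p.1.2, -p.1.1)) := by
  constructor
  · revert p
    decide
  · obtain ⟨⟨a, b⟩, q⟩ := p
    rintro ⟨h, hq⟩
    dsimp only at hq
    have hab : a = 1 ∧ b = 0 ∨ a = -1 ∧ b = 0 ∨ a = 0 ∧ b = 1 ∨ a = 0 ∧ b = -1 := by
      simp only [taxicab, Prod.fst_zero, Prod.snd_zero] at h
      omega
    rcases hab with ⟨rfl, rfl⟩ | ⟨rfl, rfl⟩ | ⟨rfl, rfl⟩ | ⟨rfl, rfl⟩ <;>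
      rcases hq with rfl | rfl <;> decide

theorem frames_swap {p : (ℤ × ℤ) × (ℤ × ℤ)} (hp : p ∈ frames) : (p.2, p.1) ∈ frames := by
  revert p
  decide

theorem taxicab_of_frame {p : (ℤ × ℤ) × (ℤ × ℤ)} (hp : p ∈ frames) {u v : ℤ × ℤ} {a b : ℤ}
    (h : u = v + (a • p.1 + b • p.2)) : taxicab u v = a.natAbs + b.natAbs := by
  subst h
  simp only [frames, List.mem_cons, List.not_mem_nil, or_false] at hp
  rcases hp with rfl | rfl | rfl | rfl | rfl | rfl | rfl | rfl <;> simp [taxicab] <;> omega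

theorem eq_or_eq_neg_of_frames {d e f : ℤ × ℤ} (he : (d, e) ∈ frames) (hf : (d, f) ∈ frames) :
    f = e ∨ f = -e := by
  have hd := mem_frames_iff.1 he
  simp only [mem_frames_iff, Prod.ext_iff, Prod.fst_neg, Prod.snd_neg] at *
  omega

namespace IsPolyominoChain

variable {n : ℕ} {c : ℕ → ℤ × ℤ}

theorem taxicab_step (hc : IsPolyominoChain n c) {j : ℕ} (hj : j + 1 < n) :
    taxicab (c (j + 1) - c j) 0 = 1 := by
  have := (hc.2 (j + 1) j hj (by omega)).2 (Or.inl rfl)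
  simpa [taxicab] using this

theorem turn_mem_frames (hc : IsPolyominoChain n c) {j : ℕ} (hj : j + 2 < n)
    (hl : link c (j + 3) = 2) : (c (j + 1) - c j, c (j + 2) - c (j + 1)) ∈ frames := by
  have h1 := hc.taxicab_step (j := j) (by omega)
  have h2 := hc.taxicab_step (j := j + 1) (by omega)
  have h3 : c (j + 2) ≠ c j := fun h => by
    have := hc.1 _ _ hj (by omega) h
    omega
  have h4 : ¬ c (j + 2) - c (j + 1) = c (j + 1) - c j := fun h => by
    simp [link, h] at hl
  rw [mem_frames_iff]
  simp only [add_assoc, Nat.reduceAdd] at h2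
  simp only [ne_eq, taxicab, Prod.ext_iff, Prod.fst_sub, Prod.snd_sub, Prod.fst_zero,
    Prod.snd_zero] at *
  omega

theorem turn_turn (hc : IsPolyominoChain n c) {j : ℕ} (hj : j + 3 < n)
    (hl : link c (j + 3) = 2) (hl' : link c (j + 4) = 2) :
    c (j + 3) - c (j + 2) = c (j + 1) - c j := by
  have h1 := frames_swap (hc.turn_mem_frames (j := j) (by omega) hl)
  have h2 := hc.turn_mem_frames (j := j + 1) (by omega) hl'
  refine (eq_or_eq_neg_of_frames h1 h2).resolve_right fun h => ?_
  have h3 := (hc.2 (j + 3) j hj (by omega)).not.2 (by omega)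
  have h4 := hc.taxicab_step (j := j + 1) (by omega)
  apply h3
  simp only [add_assoc, Nat.reduceAdd, taxicab, Prod.ext_iff, Prod.fst_sub, Prod.snd_sub,
    Prod.fst_neg, Prod.snd_neg, Prod.fst_zero, Prod.snd_zero] at *
  omega

end IsPolyominoChain

theorem straight_of_link {c : ℕ → ℤ × ℤ} {j : ℕ} (hl : link c (j + 3) = 1) :
    c (j + 2) - c (j + 1) = c (j + 1) - c j := by
  by_contra h
  simp [link, h] at hl

theorem eq_add_smul_of_links {c : ℕ → ℤ × ℤ} {a m : ℕ}
    (hl : ∀ k, a ≤ k → k + 2 ≤ m → link c (k + 3) = 1) {j : ℕ} (haj : a ≤ j) (hjm : j ≤ m) :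
    c j = c a + ((j - a : ℕ) : ℤ) • (c (a + 1) - c a) := by
  suffices h : ∀ i, a + i ≤ m → c (a + i) = c a + (i : ℤ) • (c (a + 1) - c a) by
    have := h (j - a) (by omega)
    rwa [Nat.add_sub_cancel' haj] at this
  intro i
  induction i using Nat.strong_induction_on with
  | _ i ih =>
    intro hi
    match i, ih, hi with
    | 0, _, _ => simp
    | 1, _, _ => simp
    | i + 2, ih, hi =>
      have h0 := ih i (by omega) (by omega)
      have h1 := ih (i + 1) (by omega) (by omega)
      have h2 := straight_of_link (hl (a + i) (by omega) (by omega))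
      rw [sub_eq_iff_eq_add] at h2
      rw [← add_assoc, h2, add_assoc a i 1, h1, h0]
      push_cast
      module

/-- A run of kinks is a staircase, described here by the displacements from its last cell. -/
theorem exists_staircase {n : ℕ} {c : ℕ → ℤ × ℤ} (hc : IsPolyominoChain n c) {a m : ℕ}
    (ham : a + 2 ≤ m) (hmn : m < n) (hl : ∀ k, a ≤ k → k + 2 ≤ m → link c (k + 3) = 2) :
    ∃ p ∈ frames, ∀ j, a ≤ j → j ≤ m → c j =
      c m - (((m - j + 1) / 2 : ℕ) : ℤ) • p.1 - (((m - j) / 2 : ℕ) : ℤ) • p.2 := by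
  induction m, ham using Nat.le_induction with
  | base =>
    refine ⟨_, frames_swap (hc.turn_mem_frames (j := a) hmn (hl a le_rfl le_rfl)),
      fun j h1 h2 => ?_⟩
    obtain rfl | rfl | rfl : j = a ∨ j = a + 1 ∨ j = a + 2 := by omega
    · simp
    · simp [Nat.add_sub_add_left]
    · simp
  | succ m ham ih =>
    obtain ⟨p, hp, h⟩ := ih (by omega) fun k h1 h2 => hl k h1 (by omega)
    obtain ⟨k, rfl⟩ : ∃ k, m = k + 2 := ⟨m - 2, by omega⟩
    have h3 := hc.turn_turn hmn (hl k (by omega) (by omega)) (hl (k + 1) (by omega) (by omega))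
    have h4 := h (k + 1) (by omega) (by omega)
    have h5 := h k (by omega) (by omega)
    have h6 : c (k + 3) = c (k + 2) + p.2 := by
      rw [sub_eq_iff_eq_add] at h3
      rw [h3, h4, h5]
      simp [Nat.add_sub_add_left]
      abel
    refine ⟨_, frames_swap hp, fun j h1 h2 => ?_⟩
    rcases h2.eq_or_lt with rfl | h2
    · simp
    · rw [h j h1 (by omega), show k + 2 + 1 = k + 3 by rfl, h6,
        show (k + 3 - j + 1) / 2 = (k + 2 - j) / 2 + 1 by omega,
        show (k + 3 - j) / 2 = (k + 2 - j + 1) / 2 by omega]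
      push_cast
      module

theorem gain_line : ∀ p ∈ frames, gain ((List.range 4).map fun i : ℕ =>
    (-(i + 1) : ℤ) • p.1 + (0 : ℤ) • p.2) = 32 := by
  decide +kernel

theorem ZC1_line {m : ℕ} {c : ℕ → ℤ × ℤ} {p : (ℤ × ℤ) × (ℤ × ℤ)} (hp : p ∈ frames) (hm : 4 ≤ m)
    (h : ∀ j < m, c j = c 0 + (j : ℤ) • p.1) : (ZC1 m c : ℤ) = 32 * m - 44 := by
  induction m, hm using Nat.le_induction with
  | base =>
    have hlist : ∀ p ∈ frames,
        listZC1 ((List.range 4).map fun j : ℕ => (j : ℤ) • p.1).reverse = 84 := by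
      decide +kernel
    rw [ZC1_eq_listZC1_of_eq_add _ _ h, hlist p hp]
    norm_num
  | succ m hm ih =>
    rw [ZC1_succ_of_window (K := 4) p (fun i => -(i + 1)) (fun _ => 0) hm, gain_line p hp,
      ih fun j hj => h j (by omega)]
    · push_cast
      ring
    · intro i hi
      rw [h (m - 1 - i) (by omega), h m (by omega),
        show ((m - 1 - i : ℕ) : ℤ) = m - 1 - i by omega]
      module
    · intro j hj
      rw [taxicab_of_frame hp (a := j - m) (b := 0)]
      · omega
      · rw [h j (by omega), h m (by omega)]
        module

theorem ZC1_line_with_kink_at_start {m : ℕ} {c : ℕ → ℤ × ℤ} {p : (ℤ × ℤ) × (ℤ × ℤ)}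
    (hp : p ∈ frames) (hm : 5 ≤ m) (h0 : c 0 = c 1 - p.2)
    (h : ∀ j, 1 ≤ j → j < m → c j = c 1 + ((j - 1 : ℕ) : ℤ) • p.1) :
    (ZC1 m c : ℤ) = 32 * m - 30 := by
  induction m, hm using Nat.le_induction with
  | base =>
    have hlist : ∀ p ∈ frames, listZC1 ((List.range 5).map fun j : ℕ =>
        if j = 0 then -p.2 else ((j - 1 : ℕ) : ℤ) • p.1).reverse = 130 := by
      decide +kernel
    rw [ZC1_eq_listZC1_of_eq_add (c 1) _ fun j hj => ?_, hlist p hp]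
    · norm_num
    · split_ifs with hj0
      · rw [hj0, h0, sub_eq_add_neg]
      · exact h j (by omega) hj
  | succ m hm ih =>
    rw [ZC1_succ_of_window (K := 4) p (fun i => -(i + 1)) (fun _ => 0) (by omega), gain_line p hp,
      ih fun j hj hj' => h j hj (by omega)]
    · push_cast
      ring
    · intro i hi
      rw [h (m - 1 - i) (by omega) (by omega), h m (by omega) (by omega),
        show ((m - 1 - i - 1 : ℕ) : ℤ) = m - 2 - i by omega,
        show ((m - 1 : ℕ) : ℤ) = m - 1 by omega]
      module
    · intro j hj
      rcases j.eq_zero_or_pos with rfl | hj0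
      · rw [taxicab_of_frame hp (a := -(m - 1 : ℕ)) (b := -1)]
        · omega
        · rw [h0, h m (by omega) (by omega)]
          module
      · rw [taxicab_of_frame hp (a := j - m) (b := 0)]
        · omega
        · rw [h j (by omega) (by omega), h m (by omega) (by omega),
            show ((j - 1 : ℕ) : ℤ) = j - 1 by omega, show ((m - 1 : ℕ) : ℤ) = m - 1 by omega]
          module

theorem gain_staircase : ∀ p ∈ frames, gain ((List.range 4).map fun i : ℕ =>
    (-((i + 2) / 2 : ℕ) : ℤ) • p.1 + (-((i + 1) / 2 : ℕ) : ℤ) • p.2) = 50 := by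
  decide +kernel

theorem ZC1_staircase {n m : ℕ} {c : ℕ → ℤ × ℤ} (hc : IsPolyominoChain n c) (hm : 5 ≤ m)
    (hmn : m ≤ n) (hl : ∀ k, k + 2 < m → link c (k + 3) = 2) :
    (ZC1 m c : ℤ) = 50 * m - 92 := by
  induction m, hm using Nat.le_induction with
  | base =>
    obtain ⟨p, hp, h⟩ := exists_staircase hc (a := 0) (m := 4) (by omega) (by omega)
      fun k _ hk => hl k (by omega)
    have hlist : ∀ p ∈ frames, listZC1 ((List.range 5).map fun j : ℕ =>
        -(((4 - j + 1) / 2 : ℕ) : ℤ) • p.1 - (((4 - j) / 2 : ℕ) : ℤ) • p.2).reverse = 158 := by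
      decide +kernel
    rw [ZC1_eq_listZC1_of_eq_add (c 4) _ fun j hj => ?_, hlist p hp]
    · norm_num
    · rw [h j (by omega) (by omega)]
      module
  | succ m hm ih =>
    obtain ⟨p, hp, h⟩ := exists_staircase hc (a := 0) (m := m) (by omega) (by omega)
      fun k _ hk => hl k (by omega)
    rw [ZC1_succ_of_window (K := 4) p (fun i => -((i + 2) / 2 : ℕ))
      (fun i => -((i + 1) / 2 : ℕ)) (by omega) (fun i hi => ?_) fun j hj => ?_,
      gain_staircase p hp, ih (by omega) fun j hj => hl j (by omega)]
    · push_cast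
      ring
    · rw [h (m - 1 - i) (by omega) (by omega),
        show m - (m - 1 - i) + 1 = i + 2 by omega, show m - (m - 1 - i) = i + 1 by omega]
      module
    · rw [taxicab_of_frame hp (a := -((m - j + 1) / 2 : ℕ)) (b := -((m - j) / 2 : ℕ))]
      · omega
      · rw [h j (by omega) (by omega)]
        module

theorem ZC1_staircase_with_straight_start {n m : ℕ} {c : ℕ → ℤ × ℤ} (hc : IsPolyominoChain n c)
    (hm : 5 ≤ m) (hmn : m ≤ n) (h0 : link c 3 = 1)
    (hl : ∀ k, 1 ≤ k → k + 2 < m → link c (k + 3) = 2) :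
    (ZC1 m c : ℤ) = 50 * m - 106 := by
  have hc0 : c 0 = (2 : ℤ) • c 1 - c 2 := by
    have := straight_of_link (j := 0) h0
    rw [sub_eq_iff_eq_add] at this
    rw [this]
    module
  induction m, hm using Nat.le_induction with
  | base =>
    obtain ⟨p, hp, h⟩ := exists_staircase hc (a := 1) (m := 4) (by omega) (by omega)
      fun k hk hk' => hl k hk (by omega)
    have hlist : ∀ p ∈ frames, listZC1 ((List.range 5).map fun j : ℕ =>
        if j = 0 then (-3 : ℤ) • p.1 - p.2 else
        -(((4 - j + 1) / 2 : ℕ) : ℤ) • p.1 - (((4 - j) / 2 : ℕ) : ℤ) • p.2).reverse = 144 := by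
      decide +kernel
    rw [ZC1_eq_listZC1_of_eq_add (c 4) _ fun j hj => ?_, hlist p hp]
    · norm_num
    · split_ifs with hj0
      · rw [hj0, hc0, h 1 (by omega) (by omega), h 2 (by omega) (by omega)]
        norm_num only
        module
      · rw [h j (by omega) (by omega)]
        module
  | succ m hm ih =>
    obtain ⟨p, hp, h⟩ := exists_staircase hc (a := 1) (m := m) (by omega) (by omega)
      fun k hk hk' => hl k hk (by omega)
    rw [ZC1_succ_of_window (K := 4) p (fun i => -((i + 2) / 2 : ℕ))
      (fun i => -((i + 1) / 2 : ℕ)) (by omega) (fun i hi => ?_) fun j hj => ?_,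
      gain_staircase p hp, ih (by omega) fun j hj hj' => hl j hj (by omega)]
    · push_cast
      ring
    · rw [h (m - 1 - i) (by omega) (by omega),
        show m - (m - 1 - i) + 1 = i + 2 by omega, show m - (m - 1 - i) = i + 1 by omega]
      module
    · rcases j.eq_zero_or_pos with rfl | hj0
      · rw [taxicab_of_frame hp
          (a := -2 * (m / 2 : ℕ) + ((m - 1) / 2 : ℕ))
          (b := -2 * ((m - 1) / 2 : ℕ) + ((m - 2) / 2 : ℕ))]
        · omega
        · rw [hc0, h 1 (by omega) (by omega), h 2 (by omega) (by omega),
            show m - 1 + 1 = m by omega, show m - 2 + 1 = m - 1 by omega]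
          module
      · rw [taxicab_of_frame hp (a := -((m - j + 1) / 2 : ℕ)) (b := -((m - j) / 2 : ℕ))]
        · omega
        · rw [h j (by omega) (by omega)]
          module

theorem gain_line_kink : ∀ p ∈ frames, gain ((List.range 4).map fun i : ℕ =>
    (-i : ℤ) • p.1 + (-1 : ℤ) • p.2) = 46 := by
  decide +kernel

theorem ZC1_line_with_long_kink_le {n : ℕ} {c : ℕ → ℤ × ℤ} (hn : 6 ≤ n)
    (hc : IsPolyominoChain n c) (hL : HasLinks n c fun k => if k = n - 2 then 2 else 1) :
    (ZC1 n c : ℤ) ≤ 32 * n - 24 := by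
  obtain ⟨m, rfl⟩ : ∃ m, n = m + 3 := ⟨n - 3, by omega⟩
  have hline : ∀ j < m, c j = c 0 + (j : ℤ) • (c 1 - c 0) := fun j hj =>
    eq_add_smul_of_links (a := 0) (m := m - 1)
      (fun k _ hk => (hL _ (by omega) (by omega)).trans (if_neg (by omega))) j.zero_le (by omega)
  obtain ⟨t, rfl⟩ : ∃ t, m = t + 2 := ⟨m - 2, by omega⟩
  have hturn := hc.turn_mem_frames (j := t) (by omega)
    ((hL _ (by omega) (by omega)).trans (if_pos (by omega)))
  have hs1 := straight_of_link (c := c) (j := t + 1)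
    ((hL _ (by omega) (by omega)).trans (if_neg (by omega)))
  have hs2 := straight_of_link (c := c) (j := t + 2)
    ((hL _ (by omega) (by omega)).trans (if_neg (by omega)))
  have hd : c (t + 1) - c t = c 1 - c 0 := by
    rw [hline t (by omega), hline (t + 1) (by omega)]
    push_cast
    module
  rw [hd] at hturn
  generalize c 1 - c 0 = d at *
  have h2 : c (t + 2) = c (t + 1) + (c (t + 2) - c (t + 1)) := by abel
  generalize c (t + 2) - c (t + 1) = e at *
  rw [sub_eq_iff_eq_add] at hs1 hs2
  simp only [add_assoc, Nat.reduceAdd] at hs1 hs2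
  have h3 : c (t + 3) = c (t + 1) + (2 : ℤ) • e := by rw [hs1, h2]; module
  have h4 : c (t + 4) = c (t + 1) + (3 : ℤ) • e := by rw [hs2, h3, h2]; module
  have h1 := hline (t + 1) (by omega)
  have hp := hturn
  rcases Nat.lt_or_ge t 2 with ht | ht
  · obtain rfl : t = 1 := by omega
    have hlist : ∀ p ∈ frames, listZC1 ((List.range 6).map fun j : ℕ =>
        ((min j 2 : ℕ) : ℤ) • p.1 + ((j - 2 : ℕ) : ℤ) • p.2).reverse = 166 := by
      decide +kernel
    rw [ZC1_eq_listZC1_of_eq_add (c 0) _ fun j hj => ?_, hlist _ hp]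
    · norm_num
    · interval_cases j
      · simp
      · rw [hline 1 (by omega)]; simp
      · rw [hline 2 (by omega)]; simp
      · rw [h2, h1]; simp [add_assoc]
      · rw [h3, h1]; simp [add_assoc]
      · rw [h4, h1]; simp [add_assoc]
  · have hline' (j : ℕ) (hj : j ≤ t + 1) : c j = c (t + 1) + ((j : ℤ) - (t + 1)) • d := by
      rw [hline j (by omega), h1]
      push_cast
      module
    have hgain : ∀ p ∈ frames, gain ((List.range 5).map fun i : ℕ =>
        (-(i - 1 : ℕ) : ℤ) • p.1 + (-(min (i + 1) 2 : ℕ) : ℤ) • p.2) = 36 := by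
      decide +kernel
    have hgain' : ∀ p ∈ frames, gain ((List.range 5).map fun i : ℕ =>
        (-(i - 2 : ℕ) : ℤ) • p.1 + (-(min (i + 1) 3 : ℕ) : ℤ) • p.2) = 34 := by
      decide +kernel
    rw [ZC1_succ_of_window (K := 5) (d, e) (fun i => -(i - 2 : ℕ))
        (fun i => -(min (i + 1) 3 : ℕ)) (by omega) (fun i hi => ?_) fun j hj => ?_,
      hgain' _ hp,
      ZC1_succ_of_window (K := 5) (d, e) (fun i => -(i - 1 : ℕ))
        (fun i => -(min (i + 1) 2 : ℕ)) (by omega) (fun i hi => ?_) fun j hj => ?_,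
      hgain _ hp,
      ZC1_succ_of_window (K := 4) (d, e) (fun i => -i) (fun _ => -1) (by omega)
        (fun i hi => ?_) fun j hj => ?_,
      gain_line_kink _ hp, ZC1_line hp (by omega) hline]
    · push_cast
      linarith
    · rw [h2, hline' _ (by omega), show ((t + 2 - 1 - i : ℕ) : ℤ) = t + 1 - i by omega]
      module
    · rw [taxicab_of_frame hp (a := j - (t + 1)) (b := -1)]
      · omega
      · rw [h2, hline' j (by omega)]
        module
    · rw [show t + 2 + 1 = t + 3 by rfl, h3]
      rcases i with _ | i
      · rw [show t + 3 - 1 - 0 = t + 2 by omega, h2]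
        change _ = (0 : ℤ) • d + (-1 : ℤ) • e
        module
      · rw [hline' _ (by omega), show ((t + 3 - 1 - (i + 1) : ℕ) : ℤ) = t + 1 - i by omega,
          show min (i + 1 + 1) 2 = 2 by omega, Nat.add_sub_cancel]
        module
    · rw [taxicab_of_frame hp (a := j - (t + 1)) (b := -2)]
      · omega
      · rw [show t + 2 + 1 = t + 3 by rfl, h3, hline' j (by omega)]
        module
    · rw [show t + 2 + 1 + 1 = t + 4 by rfl, h4]
      rcases i with _ | _ | i
      · rw [show t + 4 - 1 - 0 = t + 3 by omega, h3]
        change _ = (0 : ℤ) • d + (-1 : ℤ) • e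
        module
      · rw [show t + 4 - 1 - (0 + 1) = t + 2 by omega, h2]
        change _ = (0 : ℤ) • d + (-2 : ℤ) • e
        module
      · rw [hline' _ (by omega), show ((t + 4 - 1 - (i + 1 + 1) : ℕ) : ℤ) = t + 1 - i by omega,
          show min (i + 1 + 1 + 1) 3 = 3 by omega, show i + 1 + 1 - 2 = i by omega]
        module
    · rw [taxicab_of_frame hp (a := j - (t + 1)) (b := -3)]
      · omega
      · rw [show t + 2 + 1 + 1 = t + 4 by rfl, h4, hline' j (by omega)]
        module

theorem le_ZC1_line_with_kinks_at_ends {n : ℕ} {c : ℕ → ℤ × ℤ} (hn : 6 ≤ n)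
    (hc : IsPolyominoChain n c) (hL : HasLinks n c fun k => if k = 3 ∨ k = n then 2 else 1) :
    (32 * n - 16 : ℤ) ≤ ZC1 n c := by
  have hline : ∀ j, 1 ≤ j → j < n - 1 → c j = c 1 + ((j - 1 : ℕ) : ℤ) • (c 2 - c 1) :=
    fun j hj hj' => eq_add_smul_of_links (a := 1) (m := n - 2)
      (fun k hk hk' => (hL _ (by omega) (by omega)).trans (if_neg (by omega))) hj (by omega)
  obtain ⟨m, rfl⟩ : ∃ m, n = m + 3 := ⟨n - 3, by omega⟩
  have hstart := frames_swap (hc.turn_mem_frames (j := 0) (by omega)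
    ((hL _ (by omega) (by omega)).trans (if_pos (by omega))))
  have hend := hc.turn_mem_frames (j := m) (by omega)
    ((hL _ (by omega) (by omega)).trans (if_pos (by omega)))
  have h0 : c 0 = c 1 - (c 1 - c 0) := by abel
  have hd : c (m + 1) - c m = c 2 - c 1 := by
    rw [hline (m + 1) (by omega) (by omega), hline m (by omega) (by omega),
      show ((m - 1 : ℕ) : ℤ) = m - 1 by omega]
    push_cast
    module
  simp only [zero_add] at hstart
  rw [hd] at hend
  have hf : c (m + 2) = c (m + 1) + (c (m + 2) - c (m + 1)) := by abel
  generalize c 1 - c 0 = e at *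
  generalize c 2 - c 1 = d at *
  generalize c (m + 2) - c (m + 1) = f at *
  have hfe := eq_or_eq_neg_of_frames hstart hend
  rw [hline (m + 1) (by omega) (by omega), Nat.add_sub_cancel] at hf
  rcases Nat.lt_or_ge m 5 with hm | hm
  · have hlist3 : ∀ p ∈ frames, ∀ f ∈ [p.2, -p.2], 176 ≤ listZC1 ((List.range 6).map fun j : ℕ =>
        if j = 0 then -p.2 else if j = 5 then (3 : ℤ) • p.1 + f
        else ((j - 1 : ℕ) : ℤ) • p.1).reverse := by
      decide +kernel
    have hlist4 : ∀ p ∈ frames, ∀ f ∈ [p.2, -p.2], 208 ≤ listZC1 ((List.range 7).map fun j : ℕ =>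
        if j = 0 then -p.2 else if j = 6 then (4 : ℤ) • p.1 + f
        else ((j - 1 : ℕ) : ℤ) • p.1).reverse := by
      decide +kernel
    obtain rfl | rfl : m = 3 ∨ m = 4 := by omega
    · rw [ZC1_eq_listZC1_of_eq_add (c 1) _ fun j hj => ?_]
      · exact hlist3 _ hstart f (by simpa using hfe)
      · split_ifs with h1 h2
        · rw [h1, h0, sub_eq_add_neg]
        · rw [h2, hf, add_assoc]; rfl
        · exact hline j (by omega) (by omega)
    · rw [ZC1_eq_listZC1_of_eq_add (c 1) _ fun j hj => ?_]
      · exact hlist4 _ hstart f (by simpa using hfe)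
      · split_ifs with h1 h2
        · rw [h1, h0, sub_eq_add_neg]
        · rw [h2, hf, add_assoc]; rfl
        · exact hline j (by omega) (by omega)
  · rw [ZC1_succ_of_window (K := 4) (d, f) (fun i => -i) (fun _ => -1) (by omega)
        (fun i hi => ?_) fun j hj => ?_,
      gain_line_kink _ hend, ZC1_line_with_kink_at_start (m := m + 2) hstart (by omega) h0 hline]
    · push_cast
      linarith
    · rw [hf, hline _ (by omega) (by omega),
        show ((m + 2 - 1 - i - 1 : ℕ) : ℤ) = m - i by omega]
      module
    · rcases j.eq_zero_or_pos with rfl | hj0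
      · rcases hfe with rfl | rfl
        · rw [taxicab_of_frame hstart (a := -m) (b := -2)]
          · omega
          · rw [hf, h0]
            module
        · rw [taxicab_of_frame hstart (a := -m) (b := 0)]
          · omega
          · rw [hf, h0]
            module
      · rw [taxicab_of_frame hend (a := j - (m + 1)) (b := -1)]
        · omega
        · rw [hf, hline j (by omega) (by omega), show ((j - 1 : ℕ) : ℤ) = j - 1 by omega]
          module

theorem gain_staircase_straight : ∀ p ∈ frames, gain ((List.range 4).map fun i : ℕ =>
    (-((i + 1) / 2 + 1 : ℕ) : ℤ) • p.1 + (-(i / 2 : ℕ) : ℤ) • p.2) = 36 := by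
  decide +kernel

theorem le_ZC1_staircase_with_long_kink {n : ℕ} {c : ℕ → ℤ × ℤ} (hn : 6 ≤ n)
    (hc : IsPolyominoChain n c) (hL : HasLinks n c fun k => if k = n - 2 then 1 else 2) :
    (50 * n - 110 : ℤ) ≤ ZC1 n c := by
  obtain ⟨t, rfl⟩ : ∃ t, n = t + 4 := ⟨n - 4, by omega⟩
  have hkink : ∀ k, k + 2 < t + 1 → link c (k + 3) = 2 := fun k hk =>
    (hL _ (by omega) (by omega)).trans (if_neg (by omega))
  obtain ⟨⟨d, e⟩, hp, h⟩ := exists_staircase hc (a := 0) (m := t) (by omega) (by omega)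
    fun k _ hk => hkink k (by omega)
  have h' : c (t - 1) = c t - d := by
    rw [h _ (by omega) (by omega), show t - (t - 1) = 1 by omega]
    simp
  obtain ⟨s, rfl⟩ : ∃ s, t = s + 1 := ⟨t - 1, by omega⟩
  have h1 := straight_of_link (c := c) (j := s)
    ((hL _ (by omega) (by omega)).trans (if_pos (by omega)))
  have hl2 : link c (s + 4) = 2 := (hL _ (by omega) (by omega)).trans (if_neg (by omega))
  have hl3 : link c (s + 5) = 2 := (hL _ (by omega) (by omega)).trans (if_neg (by omega))
  have h2 := hc.turn_mem_frames (j := s + 1) (by omega) hl2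
  have h3 := hc.turn_turn (j := s + 1) (by omega) hl2 hl3
  simp only [add_assoc, Nat.reduceAdd, Nat.add_sub_cancel] at h1 h2 h3 h'
  rw [h', sub_sub_cancel] at h1
  rw [h1] at h2 h3
  rw [sub_eq_iff_eq_add'] at h1
  obtain ⟨f, hf⟩ : ∃ f, f = c (s + 3) - c (s + 2) := ⟨_, rfl⟩
  rw [← hf] at h2
  rw [eq_sub_iff_add_eq', eq_comm] at hf
  rw [sub_eq_iff_eq_add'] at h3
  have hfe : f = (1 : ℤ) • e ∨ f = (-1 : ℤ) • e := by
    simpa using eq_or_eq_neg_of_frames hp h2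
  replace hf : c (s + 3) = c (s + 1) + d + f := by rw [hf, h1]
  replace h3 : c (s + 4) = c (s + 1) + (2 : ℤ) • d + f := by rw [h3, hf]; module
  rcases Nat.lt_or_ge s 3 with hs | hs
  · have hlist2 : ∀ p ∈ frames, ∀ f ∈ [(1 : ℤ) • p.2, (-1 : ℤ) • p.2],
        190 ≤ listZC1 ((List.range 6).map fun j : ℕ =>
        if j = 3 then p.1 else if j = 4 then p.1 + f else if j = 5 then (2 : ℤ) • p.1 + f else
        -(((2 - j + 1) / 2 : ℕ) : ℤ) • p.1 - (((2 - j) / 2 : ℕ) : ℤ) • p.2).reverse := by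
      decide +kernel
    have hlist3 : ∀ p ∈ frames, ∀ f ∈ [(1 : ℤ) • p.2, (-1 : ℤ) • p.2],
        240 ≤ listZC1 ((List.range 7).map fun j : ℕ =>
        if j = 4 then p.1 else if j = 5 then p.1 + f else if j = 6 then (2 : ℤ) • p.1 + f else
        -(((3 - j + 1) / 2 : ℕ) : ℤ) • p.1 - (((3 - j) / 2 : ℕ) : ℤ) • p.2).reverse := by
      decide +kernel
    obtain rfl | rfl : s = 1 ∨ s = 2 := by omega
    · rw [ZC1_eq_listZC1_of_eq_add (c 2) _ fun j hj => ?_]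
      · exact hlist2 _ hp f (by simpa using hfe)
      · split_ifs with hj3 hj4 hj5
        · rw [hj3, h1]
        · rw [hj4, hf, add_assoc]
        · rw [hj5, h3, add_assoc]
        · rw [h j (by omega) (by omega)]
          module
    · rw [ZC1_eq_listZC1_of_eq_add (c 3) _ fun j hj => ?_]
      · exact hlist3 _ hp f (by simpa using hfe)
      · split_ifs with hj3 hj4 hj5
        · rw [hj3, h1]
        · rw [hj4, hf, add_assoc]
        · rw [hj5, h3, add_assoc]
        · rw [h j (by omega) (by omega)]
          module
  · obtain ⟨σ, hσ, rfl⟩ : ∃ σ ∈ ([1, -1] : List ℤ), f = σ • e := by simpa using hfe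
    have hgain : ∀ p ∈ frames, ∀ σ ∈ ([1, -1] : List ℤ), 48 ≤ gain ((List.range 6).map
        fun i : ℕ => (if i = 0 then 0 else -(i / 2 + 1 : ℕ) : ℤ) • p.1 +
          (-((i - 1) / 2 : ℕ) - σ : ℤ) • p.2) := by
      decide +kernel
    have hgain' : ∀ p ∈ frames, ∀ σ ∈ ([1, -1] : List ℤ), 48 ≤ gain ((List.range 6).map
        fun i : ℕ => (if i = 0 then -1 else if i = 1 then -1 else -((i - 1) / 2 + 2 : ℕ) : ℤ) • p.1
          + (if i = 0 then 0 else -((i - 2) / 2 : ℕ) - σ : ℤ) • p.2) := by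
      decide +kernel
    have hσ' : σ = 1 ∨ σ = -1 := by simpa using hσ
    rw [ZC1_succ_of_window (K := 6) (d, e)
        (fun i => if i = 0 then -1 else if i = 1 then -1 else -((i - 1) / 2 + 2 : ℕ))
        (fun i => if i = 0 then 0 else -((i - 2) / 2 : ℕ) - σ) (by omega)
        (fun i hi => ?_) fun j hj => ?_,
      ZC1_succ_of_window (K := 6) (d, e) (fun i => if i = 0 then 0 else -(i / 2 + 1 : ℕ))
        (fun i => -((i - 1) / 2 : ℕ) - σ) (by omega) (fun i hi => ?_) fun j hj => ?_,
      ZC1_succ_of_window (K := 4) (d, e) (fun i => -((i + 1) / 2 + 1 : ℕ))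
        (fun i => -(i / 2 : ℕ)) (by omega) (fun i hi => ?_) fun j hj => ?_,
      gain_staircase_straight _ hp, ZC1_staircase hc (m := s + 2) (by omega) (by omega) hkink]
    · have := hgain _ hp σ hσ
      have := hgain' _ hp σ hσ
      simp only [Nat.cast_add, Nat.cast_ofNat, Nat.cast_one] at *
      linarith
    · rw [h1, h _ (by omega) (by omega), show s + 1 - (s + 2 - 1 - i) = i by omega]
      push_cast
      module
    · rw [taxicab_of_frame hp (a := -((s + 1 - j + 1) / 2 + 1 : ℕ)) (b := -((s + 1 - j) / 2 : ℕ))]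
      · omega
      · rw [h1, h j (by omega) (by omega)]
        push_cast
        module
    · rw [hf]
      rcases i with _ | i
      · rw [show s + 1 + 1 + 1 - 1 - 0 = s + 2 by omega, h1]
        change _ = (0 : ℤ) • d + (-0 - σ) • e
        module
      · rw [h _ (by omega) (by omega), show s + 1 - (s + 1 + 1 + 1 - 1 - (i + 1)) = i by omega,
          if_neg (by omega), Nat.add_sub_cancel]
        push_cast
        module
    · rw [taxicab_of_frame hp (a := -((s + 1 - j + 1) / 2 + 1 : ℕ))
        (b := -((s + 1 - j) / 2 : ℕ) - σ)]
      · omega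
      · rw [hf, h j (by omega) (by omega)]
        push_cast
        module
    · rw [h3]
      rcases i with _ | _ | i
      · rw [show s + 1 + 1 + 1 + 1 - 1 - 0 = s + 3 by omega, hf]
        change _ = (-1 : ℤ) • d + (0 : ℤ) • e
        module
      · rw [show s + 1 + 1 + 1 + 1 - 1 - (0 + 1) = s + 2 by omega, h1]
        change _ = (-1 : ℤ) • d + (-0 - σ) • e
        module
      · rw [h _ (by omega) (by omega),
          show s + 1 - (s + 1 + 1 + 1 + 1 - 1 - (i + 1 + 1)) = i by omega,
          if_neg (by omega), if_neg (by omega), if_neg (by omega),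
          show i + 1 + 1 - 1 = i + 1 by omega, show i + 1 + 1 - 2 = i by omega]
        push_cast
        module
    · rw [taxicab_of_frame hp (a := -((s + 1 - j + 1) / 2 + 2 : ℕ))
        (b := -((s + 1 - j) / 2 : ℕ) - σ)]
      · omega
      · rw [h3, h j (by omega) (by omega)]
        push_cast
        module

theorem ZC1_staircase_with_straight_ends {n : ℕ} {c : ℕ → ℤ × ℤ} (hn : 6 ≤ n)
    (hc : IsPolyominoChain n c) (hL : HasLinks n c fun k => if k = 3 ∨ k = n then 1 else 2) :
    (ZC1 n c : ℤ) = 50 * n - 120 := by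
  obtain ⟨t, rfl⟩ : ∃ t, n = t + 2 := ⟨n - 2, by omega⟩
  have hkink : ∀ k, 1 ≤ k → k + 2 < t + 1 → link c (k + 3) = 2 := fun k hk hk' =>
    (hL _ (by omega) (by omega)).trans (if_neg (by omega))
  have hl0 : link c 3 = 1 := (hL _ (by omega) (by omega)).trans (if_pos (by omega))
  obtain ⟨⟨d, e⟩, hp, h⟩ := exists_staircase hc (a := 1) (m := t) (by omega) (by omega)
    fun k hk hk' => hkink k hk (by omega)
  have hc0 := straight_of_link (j := 0) hl0
  have h' : c (t - 1) = c t - d := by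
    rw [h _ (by omega) (by omega), show t - (t - 1) = 1 by omega]
    simp
  obtain ⟨s, rfl⟩ : ∃ s, t = s + 1 := ⟨t - 1, by omega⟩
  have h1 := straight_of_link (c := c) (j := s)
    ((hL _ (by omega) (by omega)).trans (if_pos (by omega)))
  rw [Nat.add_sub_cancel] at h'
  rw [h', sub_sub_cancel, sub_eq_iff_eq_add'] at h1
  rw [ZC1_succ_of_window (K := 4) (d, e) (fun i => -((i + 1) / 2 + 1 : ℕ))
      (fun i => -(i / 2 : ℕ)) (by omega) (fun i hi => ?_) fun j hj => ?_,
    gain_staircase_straight _ hp,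
    ZC1_staircase_with_straight_start hc (m := s + 2) (by omega) (by omega) hl0 hkink]
  · push_cast
    ring
  · rw [h1, h _ (by omega) (by omega), show s + 1 - (s + 2 - 1 - i) = i by omega]
    push_cast
    module
  · rcases j.eq_zero_or_pos with rfl | hj0
    · rw [taxicab_of_frame hp
        (a := -2 * ((s + 1) / 2 : ℕ) + (s / 2 : ℕ) - 1)
        (b := -2 * (s / 2 : ℕ) + ((s - 1) / 2 : ℕ))]
      · omega
      · have hc0' : c 0 = (2 : ℤ) • c 1 - c 2 := by
          rw [sub_eq_iff_eq_add] at hc0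
          rw [hc0]
          module
        rw [h1, hc0', h 1 (by omega) (by omega), h 2 (by omega) (by omega),
          show s + 1 - 1 = s by omega, show s + 1 - 2 + 1 = s by omega,
          show s + 1 - 2 = s - 1 by omega]
        module
    · rw [taxicab_of_frame hp (a := -((s + 1 - j + 1) / 2 + 1 : ℕ)) (b := -((s + 1 - j) / 2 : ℕ))]
      · omega
      · rw [h1, h j (by omega) (by omega)]
        push_cast
        module

/-- **Proposition 2.9 (final inequalities).** For `n ≥ 6`:
`ZC1(PC(1^{n-5},2,1,1)) < ZC1(PC(2,1^{n-4},2))` and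
`ZC1(PC(2^{n-5},1,2,2)) > ZC1(PC(1,2^{n-4},1))`. -/
theorem ZC1_two_kink_comparisons
    (n : ℕ) (hn : 6 ≤ n)
    (c1 c2 c3 c4 : ℕ → ℤ × ℤ)
    (hc1 : IsPolyominoChain n c1) (hc2 : IsPolyominoChain n c2)
    (hc3 : IsPolyominoChain n c3) (hc4 : IsPolyominoChain n c4)
    (hL1 : HasLinks n c1 fun k => if k = n - 2 then 2 else 1)
    (hL2 : HasLinks n c2 fun k => if k = 3 ∨ k = n then 2 else 1)
    (hL3 : HasLinks n c3 fun k => if k = n - 2 then 1 else 2)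
    (hL4 : HasLinks n c4 fun k => if k = 3 ∨ k = n then 1 else 2) :
    ZC1 n c1 < ZC1 n c2 ∧ ZC1 n c4 < ZC1 n c3 := by
  have h1 := ZC1_line_with_long_kink_le hn hc1 hL1
  have h2 := le_ZC1_line_with_kinks_at_ends hn hc2 hL2
  have h3 := le_ZC1_staircase_with_long_kink hn hc3 hL3
  have h4 := ZC1_staircase_with_straight_ends hn hc4 hL4
  omega
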